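/- Let n ≥ 1, let K be a closed subgroup of the orthogonal group O(n) acting on ℝⁿ, and let μ_K be its normalized Haar probability measure. For v₀ ∈ ℝⁿ set φ_{v₀}(x) = ∫_K exp(i ⟨k·v₀, x⟩) dμ_K(k). Let 𝒞 be the convex set of all continuous positive definite functions Γ : ℝⁿ → ℂ with Γ(0) = 1 and Γ(k x) = Γ(x) for all k ∈ K and x ∈ ℝⁿ, regarded as a convex subset of the real vector space of all functions ℝⁿ → ℂ. Then a function Γ ∈ 𝒞 is an extreme point of 𝒞 if and only if Γ = φ_{v₀} for some v₀ ∈ ℝⁿ. -/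

import Mathlib

open MeasureTheory Matrix
open scoped ComplexOrder

/-- A function `Γ : E → ℂ` is positive definite if for all finite families of points and
complex coefficients, `∑ᵢⱼ cᵢ c̄ⱼ Γ(xᵢ - xⱼ)` is a nonnegative real number. -/
def IsPosDefFn {E : Type*} [AddCommGroup E] (Γ : E → ℂ) : Prop :=
  ∀ (m : ℕ) (x : Fin m → E) (c : Fin m → ℂ),
    0 ≤ ∑ i, ∑ j, c i * (starRingEnd ℂ) (c j) * Γ (x i - x j)

open Filter Topology

theorem pd_bound {E : Type*} [AddCommGroup E] {F : E → ℂ} (hF : IsPosDefFn F) (h0 : F 0 = 1)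
    (x : E) : ‖F x‖ ≤ 1 := by
  have key : ∀ a b : ℂ, 0 ≤ a * (starRingEnd ℂ) a + a * (starRingEnd ℂ) b * F x
      + (b * (starRingEnd ℂ) a * F (-x) + b * (starRingEnd ℂ) b) := by
    intro a b
    have := hF 2 ![x, 0] ![a, b]
    simpa [Fin.sum_univ_two, h0] using this
  have h1 := (Complex.le_def.1 (key 1 1)).2
  have h2 := (Complex.le_def.1 (key Complex.I 1)).2
  simp at h1 h2
  have h3 : F (-x) = (starRingEnd ℂ) (F x) := by
    apply Complex.ext <;> simp <;> linarith
  have h4 := (Complex.le_def.1 (key ((starRingEnd ℂ) (F x)) (-(‖F x‖ : ℂ)))).1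
  rw [h3] at h4
  have h5 : (starRingEnd ℂ) (F x) * F x = ((‖F x‖ ^ 2 : ℝ) : ℂ) := by
    rw [mul_comm, Complex.mul_conj, Complex.normSq_eq_norm_sq]
  have h6 : (starRingEnd ℂ) (F x) * (starRingEnd ℂ) ((starRingEnd ℂ) (F x)) +
        (starRingEnd ℂ) (F x) * (starRingEnd ℂ) (-(‖F x‖ : ℂ)) * F x
      + (-(‖F x‖ : ℂ) * (starRingEnd ℂ) ((starRingEnd ℂ) (F x)) * (starRingEnd ℂ) (F x)
        + -(‖F x‖ : ℂ) * (starRingEnd ℂ) (-(‖F x‖ : ℂ)))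
      = ((2 * ‖F x‖ ^ 2 - 2 * ‖F x‖ ^ 3 : ℝ) : ℂ) := by
    simp only [Complex.conj_conj, map_neg, Complex.conj_ofReal]
    push_cast at h5 ⊢
    linear_combination (1 - 2 * (‖F x‖ : ℂ)) * h5
  rw [h6] at h4
  simp only [Complex.zero_re, Complex.ofReal_re] at h4
  by_contra hlt
  push Not at hlt
  nlinarith [mul_pos (pow_pos (zero_lt_one.trans hlt) 2) (sub_pos.2 hlt)]

theorem pd_double {E : Type*} [AddCommGroup E] [MeasurableSpace E] [MeasurableSub₂ E]
    {F : E → ℂ} (hF : IsPosDefFn F) (h0 : F 0 = 1) (hm : Measurable F)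
    (ν : Measure E) [IsProbabilityMeasure ν] :
    0 ≤ ∫ p, F (p.2 - p.1) ∂(ν.prod ν) := by
  set J := ∫ p, F (p.2 - p.1) ∂(ν.prod ν) with hJ
  have hint : ∀ (N : ℕ) (i j : Fin N),
      Integrable (fun x : Fin N → E => F (x i - x j)) (Measure.pi fun _ => ν) := by
    intro N i j
    refine Integrable.mono' (integrable_const (1 : ℝ)) ?_ (ae_of_all _ fun x => pd_bound hF h0 _)
    exact (hm.comp ((measurable_pi_apply i).sub (measurable_pi_apply j))).aestronglyMeasurable
  have hpair : ∀ (N : ℕ) (i j : Fin N), i ≠ j →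
      ∫ x : Fin N → E, F (x i - x j) ∂(Measure.pi fun _ => ν) = J := by
    intro N i j hij
    have hind : ProbabilityTheory.IndepFun (fun x : Fin N → E => x j) (fun x => x i)
        (Measure.pi fun _ => ν) :=
      (ProbabilityTheory.iIndepFun_pi (μ := fun _ : Fin N => ν) (X := fun _ => id)
        (fun _ => aemeasurable_id)).indepFun hij.symm
    rw [ProbabilityTheory.indepFun_iff_map_prod_eq_prod_map_map
      (measurable_pi_apply j).aemeasurable (measurable_pi_apply i).aemeasurable] at hind
    have e1 : ∀ k : Fin N, Measure.map (fun x : Fin N → E => x k) (Measure.pi fun _ => ν) = ν :=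
      fun k => (measurePreserving_eval (fun _ : Fin N => ν) k).map_eq
    rw [e1, e1] at hind
    rw [hJ, ← hind, integral_map]
    · exact ((measurable_pi_apply j).prodMk (measurable_pi_apply i)).aemeasurable
    · exact (hm.comp (measurable_snd.sub measurable_fst)).aestronglyMeasurable
  have hN : ∀ N : ℕ, 0 ≤ (N + 1 : ℂ) + (N + 1) * N * J := by
    intro N
    have h : 0 ≤ ∫ x : Fin (N + 1) → E, ∑ i, ∑ j, F (x i - x j) ∂(Measure.pi fun _ => ν) := by
      apply integral_nonneg
      intro x
      simpa using hF (N + 1) x (fun _ => 1)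
    rw [integral_finsetSum _ (fun i _ => integrable_finsetSum _ (fun j _ => hint _ i j))] at h
    have e : ∀ i : Fin (N + 1), ∫ x : Fin (N + 1) → E, ∑ j, F (x i - x j) ∂(Measure.pi fun _ => ν)
        = 1 + N * J := by
      intro i
      rw [integral_finsetSum _ (fun j _ => hint _ i j), ← Finset.add_sum_erase _ _ (Finset.mem_univ i),
        Finset.sum_congr rfl (fun j hj => hpair _ i j (Finset.ne_of_mem_erase hj).symm)]
      simp [h0]
    rw [Finset.sum_congr rfl (fun i _ => e i)] at h
    simp at h
    convert h using 1
    ring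
  have hN2 : ∀ N : ℕ, 0 ≤ (((1 : ℝ) / ((N : ℝ) + 1) : ℝ) : ℂ) + (1 - (((1 : ℝ) / ((N : ℝ) + 1) : ℝ) : ℂ)) * J := by
    intro N
    have hp : (0 : ℂ) ≤ ((((1 : ℝ) / ((N : ℝ) + 1)) ^ 2 : ℝ) : ℂ) := by
      rw [Complex.zero_le_real]; positivity
    have := mul_nonneg hp (hN N)
    convert this using 1
    have : (N + 1 : ℂ) ≠ 0 := by exact_mod_cast Nat.succ_ne_zero N
    push_cast
    field_simp
    ring
  have hlim : Tendsto (fun N : ℕ => (((1 : ℝ) / ((N : ℝ) + 1) : ℝ) : ℂ)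
      + (1 - (((1 : ℝ) / ((N : ℝ) + 1) : ℝ) : ℂ)) * J) atTop (𝓝 (((0 : ℝ) : ℂ) + (1 - ((0 : ℝ) : ℂ)) * J)) := by
    have t := (Complex.continuous_ofReal.tendsto 0).comp tendsto_one_div_add_atTop_nhds_zero_nat
    exact t.add ((tendsto_const_nhds.sub t).mul_const J)
  have := ge_of_tendsto' hlim hN2
  simpa using this

theorem pd_gauss {V : Type*} [NormedAddCommGroup V] [InnerProductSpace ℝ V] [FiniteDimensional ℝ V]
    [MeasurableSpace V] [BorelSpace V]
    {F : V → ℂ} (hF : IsPosDefFn F) (h0 : F 0 = 1) (hc : Continuous F) {b : ℝ} (hb : 0 < b) :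
    0 ≤ ∫ z, F z * ((Real.exp (-b * ‖z‖ ^ 2) : ℝ) : ℂ) := by
  have hgi : ∀ a : ℝ, 0 < a → Integrable (fun v : V => Real.exp (-a * ‖v‖ ^ 2)) := by
    intro a ha
    have := (GaussianFourier.integrable_cexp_neg_mul_sq_norm_add (V := V) (b := (a : ℂ))
      (by simpa using ha) 0 0).re
    refine this.congr (ae_of_all _ fun v => ?_)
    simp only [inner_zero_left, Complex.ofReal_zero, mul_zero, add_zero]
    have : (-(a : ℂ) * (‖v‖ : ℂ) ^ 2) = ((-a * ‖v‖ ^ 2 : ℝ) : ℂ) := by push_cast; ring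
    rw [this, ← Complex.ofReal_exp]
    rfl
  have hpos : ∀ a : ℝ, 0 < a → 0 < ∫ v : V, Real.exp (-a * ‖v‖ ^ 2) := by
    intro a ha
    rw [GaussianFourier.integral_rexp_neg_mul_sq_norm ha]
    positivity
  set Z := ∫ v : V, Real.exp (-(2 * b) * ‖v‖ ^ 2) with hZ
  have hZpos : 0 < Z := hpos _ (by positivity)
  set q : V → ℝ := fun v => Z⁻¹ * Real.exp (-(2 * b) * ‖v‖ ^ 2) with hq
  have hqi : Integrable q := (hgi _ (by positivity)).const_mul _
  have hq0 : ∀ v, 0 ≤ q v := fun v => by positivity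
  have hqc : Continuous q := by fun_prop
  have hq1 : ∫ v, q v = 1 := by
    rw [hq, integral_const_mul, ← hZ, inv_mul_cancel₀ hZpos.ne']
  set ν : Measure V := volume.withDensity (fun v => ENNReal.ofReal (q v)) with hν
  have hνp : IsProbabilityMeasure ν := by
    constructor
    rw [hν, withDensity_apply _ MeasurableSet.univ, Measure.restrict_univ,
      ← ofReal_integral_eq_lintegral_ofReal hqi (ae_of_all _ hq0), hq1, ENNReal.ofReal_one]
  have hmain := pd_double hF h0 hc.measurable ν
  have hprod : ν.prod ν = ((volume : Measure V).prod (volume : Measure V)).withDensity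
      (fun p => ENNReal.ofReal (q p.1 * q p.2)) := by
    rw [hν, prod_withDensity (by fun_prop) (by fun_prop)]
    congr with p
    rw [ENNReal.ofReal_mul (hq0 _)]
  rw [hprod, integral_withDensity_eq_integral_toReal_smul (by fun_prop)
    (ae_of_all _ fun _ => ENNReal.ofReal_lt_top)] at hmain
  have e1 : (fun p : V × V => (ENNReal.ofReal (q p.1 * q p.2)).toReal • F (p.2 - p.1))
      = fun p => ((q p.1 * q p.2 : ℝ) : ℂ) * F (p.2 - p.1) := by
    ext p
    rw [ENNReal.toReal_ofReal (mul_nonneg (hq0 _) (hq0 _))]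
    simp
  rw [e1] at hmain
  have hI : Integrable (fun p : V × V => ((q p.1 * q p.2 : ℝ) : ℂ) * F (p.2 - p.1))
      ((volume : Measure V).prod volume) := by
    refine Integrable.mono' (hqi.mul_prod hqi) ?_ (ae_of_all _ fun p => ?_)
    · exact Continuous.aestronglyMeasurable (by fun_prop)
    · rw [norm_mul, Complex.norm_real, Real.norm_of_nonneg (mul_nonneg (hq0 _) (hq0 _))]
      exact mul_le_of_le_one_right (mul_nonneg (hq0 _) (hq0 _)) (pd_bound hF h0 _)
  have hmp := measurePreserving_prod_add (volume : Measure V) (volume : Measure V)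
  have hemb : MeasurableEmbedding (fun z : V × V => (z.1, z.1 + z.2)) :=
    (MeasurableEquiv.shearAddRight V).measurableEmbedding
  have hI2 := (hmp.integrable_comp_emb hemb).2 hI
  rw [← hmp.integral_comp hemb] at hmain
  have hsym := integral_prod_symm _ hI2
  simp only [Function.comp_def] at hsym
  dsimp only at hmain
  rw [hsym] at hmain
  set C := ∫ v : V, Real.exp (-(4 * b) * ‖v‖ ^ 2) with hC
  have hCpos : 0 < C := hpos _ (by positivity)
  have e2 : ∀ z : V, ∫ y : V, ((q y * q (y + z) : ℝ) : ℂ) * F (y + z - y)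
      = ((Z⁻¹ ^ 2 * C : ℝ) : ℂ) * (F z * ((Real.exp (-b * ‖z‖ ^ 2) : ℝ) : ℂ)) := by
    intro z
    have e3 : ∀ y : V, ((q y * q (y + z) : ℝ) : ℂ) * F (y + z - y)
      = ((Real.exp (-(4 * b) * ‖y + (2⁻¹ : ℝ) • z‖ ^ 2) : ℝ) : ℂ) *
        ((Z⁻¹ ^ 2 : ℝ) * (F z * ((Real.exp (-b * ‖z‖ ^ 2) : ℝ) : ℂ))) := by
      intro y
      have : q y * q (y + z) = Real.exp (-(4 * b) * ‖y + (2⁻¹ : ℝ) • z‖ ^ 2) *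
          (Z⁻¹ ^ 2 * Real.exp (-b * ‖z‖ ^ 2)) := by
        simp only [hq]
        have : Real.exp (-(2 * b) * ‖y‖ ^ 2) * Real.exp (-(2 * b) * ‖y + z‖ ^ 2) =
          Real.exp (-(4 * b) * ‖y + (2⁻¹ : ℝ) • z‖ ^ 2) * Real.exp (-b * ‖z‖ ^ 2) := by
          rw [← Real.exp_add, ← Real.exp_add, norm_add_sq_real, norm_add_sq_real, norm_smul,
            inner_smul_right]
          congr 1
          rw [mul_pow]
          norm_num
          ring
        linear_combination Z⁻¹ ^ 2 * this
      rw [this, add_sub_cancel_left]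
      push_cast
      ring
    simp_rw [e3]
    rw [integral_mul_const, integral_complex_ofReal,
      integral_add_right_eq_self (μ := (volume : Measure V)) (fun y : V => Real.exp (-(4 * b) * ‖y‖ ^ 2)), ← hC]
    push_cast
    ring
  simp_rw [e2] at hmain
  rw [integral_const_mul] at hmain
  have hk : 0 < Z⁻¹ ^ 2 * C := by positivity
  have hk' : (0 : ℂ) ≤ (((Z⁻¹ ^ 2 * C)⁻¹ : ℝ) : ℂ) := by
    rw [Complex.zero_le_real]; positivity
  have := mul_nonneg hk' hmain
  rw [← mul_assoc, ← Complex.ofReal_mul, inv_mul_cancel₀ hk.ne', Complex.ofReal_one, one_mul] at this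
  exact this

theorem pd_mul_char {E : Type*} [AddCommGroup E] {F : E → ℂ} (hF : IsPosDefFn F) (l : E →+ ℝ) :
    IsPosDefFn (fun x => Complex.exp ((l x : ℝ) * Complex.I) * F x) := by
  intro m x c
  have := hF m x (fun i => c i * Complex.exp ((l (x i) : ℝ) * Complex.I))
  convert this using 1
  refine Finset.sum_congr rfl fun i _ => Finset.sum_congr rfl fun j _ => ?_
  have : Complex.exp ((l (x i - x j) : ℝ) * Complex.I) =
      Complex.exp ((l (x i) : ℝ) * Complex.I) *
        (starRingEnd ℂ) (Complex.exp ((l (x j) : ℝ) * Complex.I)) := by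
    rw [← Complex.exp_conj, ← Complex.exp_add]
    congr 1
    simp
    ring
  beta_reduce
  rw [this, map_mul]
  ring

section
variable {V : Type*} [NormedAddCommGroup V] [InnerProductSpace ℝ V] [FiniteDimensional ℝ V]
    [MeasurableSpace V] [BorelSpace V]

open FourierTransform RealInnerProductSpace

theorem integrable_fourier_of_nonneg {f : V → ℂ} (hf : Integrable f) (h0 : ContinuousAt f 0)
    (hpos : ∀ w, 0 ≤ 𝓕 f w) : Integrable (𝓕 f) := by
  have hcont : Continuous (𝓕 f) :=
    VectorFourier.fourierIntegral_continuous Real.continuous_fourierChar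
      (L := innerₗ V) continuous_inner hf
  have hlim := Real.tendsto_integral_gaussian_smul' hf h0
  have hbd : ∀ w, ‖𝓕 f w‖ ≤ ∫ v, ‖f v‖ := fun w =>
    VectorFourier.norm_fourierIntegral_le_integral_norm _ _ _ _ _
  have J : ∀ c : ℝ, 0 < c → Integrable (fun w : V ↦ Complex.exp (- (c : ℂ)⁻¹ * ‖w‖ ^ 2)) := by
    intro c hc
    have := GaussianFourier.integrable_cexp_neg_mul_sq_norm_add (V := V) (b := ((c : ℂ)⁻¹))
      (by rw [← Complex.ofReal_inv, Complex.ofReal_re]; positivity) 0 0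
    simpa using this
  have hlim2 : Tendsto (fun c : ℝ => ∫ w : V, Complex.exp (- (c : ℂ)⁻¹ * ‖w‖ ^ 2) • (𝓕 f) w)
      atTop (𝓝 (f 0)) := by
    apply hlim.congr'
    filter_upwards [Ioi_mem_atTop 0] with c (hc : 0 < c)
    have e := (VectorFourier.integral_fourierIntegral_smul_eq_flip (L := innerₗ V)
      Real.continuous_fourierChar continuous_inner (J c hc) hf)
    have e' : ∫ w : V, 𝓕 (fun w : V ↦ Complex.exp (- (c : ℂ)⁻¹ * ‖w‖ ^ 2)) w • f w =
        ∫ w : V, Complex.exp (- (c : ℂ)⁻¹ * ‖w‖ ^ 2) • (𝓕 f) w := by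
      simpa using! e
    rw [← e']
    congr with w
    rw [fourier_gaussian_innerProductSpace (by rw [← Complex.ofReal_inv, Complex.ofReal_re]; positivity)]
    rw [zero_sub, norm_neg, div_inv_eq_mul, div_inv_eq_mul]
    congr 3
    ring
  have hlim3 := hlim2.comp (tendsto_natCast_atTop_atTop (R := ℝ))
  have hlim4 := (hlim3.enorm)
  refine ⟨hcont.aestronglyMeasurable, ?_⟩
  have hF : ∫⁻ w, ‖𝓕 f w‖ₑ ≤ liminf (fun k : ℕ =>
      ∫⁻ w, ‖Complex.exp (- ((k : ℝ) : ℂ)⁻¹ * ‖w‖ ^ 2) • (𝓕 f) w‖ₑ) atTop := by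
    refine le_trans (lintegral_mono fun w => ?_) (lintegral_liminf_le' fun k => ?_)
    · have : Tendsto (fun k : ℕ => ‖Complex.exp (- ((k : ℝ) : ℂ)⁻¹ * ‖w‖ ^ 2) • (𝓕 f) w‖ₑ) atTop
          (𝓝 ‖Complex.exp (- ((0 : ℝ) : ℂ) * ‖w‖ ^ 2) • (𝓕 f) w‖ₑ) := by
        apply Tendsto.enorm
        apply Tendsto.smul_const
        apply (Complex.continuous_exp.tendsto _).comp
        apply Tendsto.mul_const
        apply Tendsto.neg
        have := (Complex.continuous_ofReal.tendsto 0).comp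
          (tendsto_inv_atTop_zero.comp (tendsto_natCast_atTop_atTop (R := ℝ)))
        refine this.congr fun k => ?_
        simp
      rw [this.liminf_eq]
      simp
    · exact Continuous.aemeasurable (by fun_prop)
  have hE : ∀ᶠ k : ℕ in atTop, ‖∫ w : V, Complex.exp (- ((k : ℝ) : ℂ)⁻¹ * ‖w‖ ^ 2) • (𝓕 f) w‖ₑ =
      ∫⁻ w, ‖Complex.exp (- ((k : ℝ) : ℂ)⁻¹ * ‖w‖ ^ 2) • (𝓕 f) w‖ₑ := by
    filter_upwards [Ioi_mem_atTop 0] with k (hk : 0 < k)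
    have hk' : (0 : ℝ) < k := by exact_mod_cast hk
    have hI : Integrable (fun w => Complex.exp (- ((k : ℝ) : ℂ)⁻¹ * ‖w‖ ^ 2) • (𝓕 f) w) :=
      (J k hk').mul_bdd (c := ∫ v, ‖f v‖) hcont.aestronglyMeasurable (ae_of_all _ hbd)
    have hr : ∀ w, Complex.exp (- ((k : ℝ) : ℂ)⁻¹ * ‖w‖ ^ 2) • (𝓕 f) w =
        ((‖Complex.exp (- ((k : ℝ) : ℂ)⁻¹ * ‖w‖ ^ 2) • (𝓕 f) w‖ : ℝ) : ℂ) := by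
      intro w
      have h1 : 0 ≤ Complex.exp (- ((k : ℝ) : ℂ)⁻¹ * ‖w‖ ^ 2) := by
        have : (- ((k : ℝ) : ℂ)⁻¹ * ‖w‖ ^ 2) = ((-(k : ℝ)⁻¹ * ‖w‖ ^ 2 : ℝ) : ℂ) := by push_cast; ring
        rw [this, ← Complex.ofReal_exp, Complex.zero_le_real]
        positivity
      have h2 := mul_nonneg h1 (hpos w)
      rw [smul_eq_mul]
      exact (Complex.eq_coe_norm_of_nonneg h2)
    rw [← ofReal_integral_norm_eq_lintegral_enorm hI, ← ofReal_norm]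
    congr 1
    conv_lhs => rw [integral_congr_ae (ae_of_all _ hr), integral_complex_ofReal, Complex.norm_real]
    exact Real.norm_of_nonneg (integral_nonneg fun _ => norm_nonneg _)
  have hlim5 := hlim4.congr' hE
  rw [hlim5.liminf_eq] at hF
  exact lt_of_le_of_lt hF (by simp)

theorem levy_limit {μ : ℕ → Measure V} [∀ i, IsProbabilityMeasure (μ i)]
    {f : V → ℂ} (hf : ContinuousAt f 0)
    (h : ∀ t, Tendsto (fun n ↦ charFun (μ n) t) atTop (𝓝 (f t))) :
    ∃ μ₀ : Measure V, IsProbabilityMeasure μ₀ ∧ charFun μ₀ = f := by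
  have ht := isTightMeasureSet_of_tendsto_charFun hf h
  let P : ℕ → ProbabilityMeasure V := fun n => ⟨μ n, inferInstance⟩
  have h_compact : IsCompact (closure (Set.range P)) := by
    apply isCompact_closure_of_isTightMeasureSet
    convert! ht using 1
    ext ρ
    constructor
    · rintro ⟨_, ⟨n, rfl⟩, rfl⟩
      exact ⟨n, rfl⟩
    · rintro ⟨n, rfl⟩
      exact ⟨P n, ⟨n, rfl⟩, rfl⟩
  let U : Ultrafilter ℕ := hyperfilter ℕ
  obtain ⟨μ', -, hμ'⟩ := h_compact.ultrafilter_le_nhds (U.map P)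
    (.trans (by simp) (monotone_principal subset_closure))
  have hμ' : Tendsto P U (𝓝 μ') := hμ'
  refine ⟨μ', inferInstance, ?_⟩
  ext t
  rw [ProbabilityMeasure.tendsto_iff_forall_integral_rclike_tendsto ℂ] at hμ'
  have h1 := hμ' (BoundedContinuousFunction.innerProbChar t)
  simp_rw [← charFun_eq_integral_innerProbChar] at h1
  exact tendsto_nhds_unique h1 ((h t).mono_left Nat.hyperfilter_le_atTop)
end

section
variable {V : Type*} [NormedAddCommGroup V] [InnerProductSpace ℝ V] [FiniteDimensional ℝ V]
    [MeasurableSpace V] [BorelSpace V]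

open FourierTransform RealInnerProductSpace

theorem bochner_step {F : V → ℂ} (hF : IsPosDefFn F) (h0 : F 0 = 1) (hc : Continuous F)
    {b : ℝ} (hb : 0 < b) : ∃ μ : Measure V, IsProbabilityMeasure μ ∧
      ∀ t, charFun μ t = F t * ((Real.exp (-b * ‖t‖ ^ 2) : ℝ) : ℂ) := by
  set g : V → ℂ := fun t => F t * ((Real.exp (-b * ‖t‖ ^ 2) : ℝ) : ℂ) with hg
  have hgc : Continuous g := by fun_prop
  have hgi : Integrable g := by
    have := (GaussianFourier.integrable_cexp_neg_mul_sq_norm_add (V := V) (b := (b : ℂ))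
      (by simpa using hb) 0 0)
    refine (this.bdd_mul (c := 1) hc.aestronglyMeasurable
      (ae_of_all _ (pd_bound hF h0))).congr (ae_of_all _ fun v => ?_)
    simp [hg]
  have hpos : ∀ w, 0 ≤ 𝓕 g w := by
    intro w
    let l : V →+ ℝ := 
      { toFun := fun v => -2 * Real.pi * ⟪v, w⟫
        map_zero' := by simp
        map_add' := fun x y => by rw [inner_add_left]; ring }
    have hl : ∀ v, l v = -2 * Real.pi * ⟪v, w⟫ := fun v => rfl
    have := pd_gauss (pd_mul_char hF l) (by simp [h0])
      (by simp only [hl]; fun_prop) hb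
    rw [Real.fourier_eq']
    refine this.trans_eq (integral_congr_ae (ae_of_all _ fun v => ?_))
    simp only [hl, smul_eq_mul, hg, mul_assoc]
  have hfi : Integrable (𝓕 g) := integrable_fourier_of_nonneg hgi hgc.continuousAt hpos
  have hfc : Continuous (𝓕 g) :=
    VectorFourier.fourierIntegral_continuous Real.continuous_fourierChar
      (L := innerₗ V) continuous_inner hgi
  have hinv := hgc.fourierInv_fourier_eq hgi hfi
  set ρ : Measure V := volume.withDensity (fun v => ENNReal.ofReal (𝓕 g v).re) with hρ
  have hre : ∀ v, 𝓕 g v = (((𝓕 g v).re : ℝ) : ℂ) := fun v =>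
    Complex.ext rfl (by simpa using (Complex.le_def.1 (hpos v)).2.symm)
  have hre0 : ∀ v, 0 ≤ (𝓕 g v).re := fun v => (Complex.le_def.1 (hpos v)).1
  have hρf : IsFiniteMeasure ρ := isFiniteMeasure_withDensity_ofReal hfi.re.2
  have hchar : ∀ t, charFun (ρ.map ((2 * Real.pi) • ·)) t = g t := by
    intro t
    rw [charFun_map_smul, charFun_apply, hρ, integral_withDensity_eq_integral_toReal_smul
      (by fun_prop) (ae_of_all _ fun _ => ENNReal.ofReal_lt_top), ← congrFun hinv t,
      Real.fourierInv_eq']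
    congr with v
    rw [ENNReal.toReal_ofReal (hre0 v), inner_smul_right, smul_eq_mul, mul_comm, Complex.real_smul,
      ← hre v, mul_comm]
  have hfin : IsFiniteMeasure (ρ.map ((2 * Real.pi) • ·)) := inferInstance
  refine ⟨ρ.map ((2 * Real.pi) • ·), ⟨?_⟩, hchar⟩
  have h1 := hchar 0
  rw [charFun_zero] at h1
  simp only [hg, h0, norm_zero] at h1
  norm_num at h1
  have h2 : (ρ.map ((2 * Real.pi) • ·)).real Set.univ = 1 := by exact_mod_cast h1
  rwa [measureReal_def, ENNReal.toReal_eq_one_iff] at h2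

theorem bochner {F : V → ℂ} (hF : IsPosDefFn F) (h0 : F 0 = 1) (hc : Continuous F) :
    ∃ μ : Measure V, IsProbabilityMeasure μ ∧ charFun μ = F := by
  have H := fun k : ℕ => bochner_step hF h0 hc (b := 1 / ((k : ℝ) + 1)) (by positivity)
  choose μ hμ hch using H
  refine levy_limit (μ := μ) hc.continuousAt fun t => ?_
  simp_rw [hch]
  have : Tendsto (fun n : ℕ => F t * ((Real.exp (-(1 / ((n : ℝ) + 1)) * ‖t‖ ^ 2) : ℝ) : ℂ)) atTop
      (𝓝 (F t * ((Real.exp (-0 * ‖t‖ ^ 2) : ℝ) : ℂ))) := by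
    apply Tendsto.const_mul
    apply (Complex.continuous_ofReal.tendsto _).comp
    apply (Real.continuous_exp.tendsto _).comp
    exact (tendsto_one_div_add_atTop_nhds_zero_nat.neg).mul_const _
  simpa using this
end

theorem bochner_pi {n : ℕ} {F : (Fin n → ℝ) → ℂ} (hF : IsPosDefFn F) (h0 : F 0 = 1)
    (hc : Continuous F) : ∃ μ : Measure (Fin n → ℝ), IsProbabilityMeasure μ ∧
      ∀ x, F x = ∫ v, Complex.exp (Complex.I * (↑(∑ i, v i * x i) : ℂ)) ∂μ := by
  obtain ⟨μ, hμ, h⟩ := bochner (V := EuclideanSpace ℝ (Fin n)) (F := fun x => F x.ofLp)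
    (fun m x c => by simpa using hF m (fun i => (x i).ofLp) c) (by simpa using h0) (by fun_prop)
  have hm : Measurable (fun x : EuclideanSpace ℝ (Fin n) => x.ofLp) := by fun_prop
  refine ⟨μ.map (fun x => x.ofLp), Measure.isProbabilityMeasure_map hm.aemeasurable, fun x => ?_⟩
  rw [integral_map hm.aemeasurable (Continuous.aestronglyMeasurable (by fun_prop))]
  have := congrFun h (WithLp.toLp 2 x)
  rw [← this, charFun_apply]
  congr with v
  rw [mul_comm]
  congr 3
  simp [PiLp.inner_apply, mul_comm]

theorem char_ext {n : ℕ} {μ ν : Measure (Fin n → ℝ)} [IsFiniteMeasure μ] [IsFiniteMeasure ν]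
    (h : ∀ x : Fin n → ℝ, ∫ v, Complex.exp (Complex.I * (↑(∑ i, v i * x i) : ℂ)) ∂μ
      = ∫ v, Complex.exp (Complex.I * (↑(∑ i, v i * x i) : ℂ)) ∂ν) : μ = ν := by
  have hm : Measurable (fun x : Fin n → ℝ => (WithLp.toLp 2 x : EuclideanSpace ℝ (Fin n))) := by fun_prop
  have hm' : Measurable (fun x : EuclideanSpace ℝ (Fin n) => x.ofLp) := by fun_prop
  have key : μ.map (fun x : Fin n → ℝ => (WithLp.toLp 2 x : EuclideanSpace ℝ (Fin n)))
      = ν.map (fun x : Fin n → ℝ => (WithLp.toLp 2 x : EuclideanSpace ℝ (Fin n))) := by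
    apply Measure.ext_of_charFun
    ext t
    rw [charFun_apply, charFun_apply,
      integral_map hm.aemeasurable (Continuous.aestronglyMeasurable (by fun_prop)),
      integral_map hm.aemeasurable (Continuous.aestronglyMeasurable (by fun_prop))]
    have e : ∀ v : Fin n → ℝ, Complex.exp (((inner ℝ (WithLp.toLp 2 v : EuclideanSpace ℝ (Fin n)) t : ℝ) : ℂ) * Complex.I)
        = Complex.exp (Complex.I * (↑(∑ i, v i * t.ofLp i) : ℂ)) := by
      intro v
      rw [mul_comm]
      congr 3
      simp [PiLp.inner_apply, mul_comm]
    simp_rw [e]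
    exact h t.ofLp
  have := congrArg (fun m => Measure.map (fun x : EuclideanSpace ℝ (Fin n) => x.ofLp) m) key
  simpa [Measure.map_map hm' hm, Function.comp_def] using this

noncomputable def ee {n : ℕ} (v x : Fin n → ℝ) : ℂ :=
  Complex.exp (Complex.I * (↑(∑ i, v i * x i) : ℂ))

@[fun_prop]
theorem ee_cont {n : ℕ} {X : Type*} [TopologicalSpace X] {f g : X → Fin n → ℝ}
    (hf : Continuous f) (hg : Continuous g) : Continuous fun p => ee (f p) (g p) := by
  unfold ee; fun_prop

theorem ee_norm {n : ℕ} (v x : Fin n → ℝ) : ‖ee v x‖ = 1 := by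
  rw [ee, mul_comm, Complex.norm_exp_ofReal_mul_I]

theorem ee_zero {n : ℕ} (v : Fin n → ℝ) : ee v 0 = 1 := by simp [ee]

theorem ee_adj {n : ℕ} (A : Matrix (Fin n) (Fin n) ℝ) (v x : Fin n → ℝ) :
    ee (A.mulVec v) x = ee v (Aᵀ.mulVec x) := by
  have : A.mulVec v ⬝ᵥ x = v ⬝ᵥ Aᵀ.mulVec x := by
    rw [Matrix.mulVec_transpose, dotProduct_comm, Matrix.dotProduct_mulVec, dotProduct_comm]
  simp only [dotProduct] at this
  rw [ee, ee, this]

theorem ee_pd {n : ℕ} (v : Fin n → ℝ) : IsPosDefFn (ee v) := by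
  have h1 : IsPosDefFn (fun _ : Fin n → ℝ => (1 : ℂ)) := by
    intro m x c
    have : ∑ i, ∑ j, c i * (starRingEnd ℂ) (c j) * (1 : ℂ) = (∑ i, c i) * star (∑ i, c i) := by
      simp [Finset.sum_mul_sum]
    rw [this]
    exact mul_star_self_nonneg _
  have h2 := pd_mul_char h1
    ({ toFun := fun x => ∑ i, v i * x i
       map_zero' := by simp
       map_add' := fun x y => by simp [mul_add, Finset.sum_add_distrib] } : (Fin n → ℝ) →+ ℝ)
  convert h2 using 2 with x
  simp [ee, mul_comm]

theorem pd_integral {E X : Type*} [AddCommGroup E] [MeasurableSpace X] {μ : Measure X}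
    {F : X → E → ℂ} (hF : ∀ a, IsPosDefFn (F a)) (hi : ∀ x, Integrable (fun a => F a x) μ) :
    IsPosDefFn (fun x => ∫ a, F a x ∂μ) := by
  intro m x c
  have : ∑ i, ∑ j, c i * (starRingEnd ℂ) (c j) * ∫ a, F a (x i - x j) ∂μ
      = ∫ a, ∑ i, ∑ j, c i * (starRingEnd ℂ) (c j) * F a (x i - x j) ∂μ := by
    rw [integral_finsetSum]
    · refine Finset.sum_congr rfl fun i _ => ?_
      rw [integral_finsetSum]
      · refine Finset.sum_congr rfl fun j _ => ?_
        rw [integral_const_mul]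
      · intro j _; exact (hi _).const_mul _
    · intro i _
      exact integrable_finsetSum _ fun j _ => (hi _).const_mul _
  rw [this]
  exact integral_nonneg fun a => hF a m x c

section
variable {n : ℕ}
    [MeasurableSpace (Matrix (Fin n) (Fin n) ℝ)] [BorelSpace (Matrix (Fin n) (Fin n) ℝ)]

theorem mat_sc (n : ℕ) : SecondCountableTopology (Matrix (Fin n) (Fin n) ℝ) :=
  inferInstanceAs (SecondCountableTopology (Fin n → Fin n → ℝ))

theorem bdd_int {X : Type*} [TopologicalSpace X] [MeasurableSpace X] [OpensMeasurableSpace X]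
    {μ : Measure X} [IsFiniteMeasure μ] {f : X → ℂ} (hf : Continuous f) {C : ℝ}
    (hb : ∀ a, ‖f a‖ ≤ C) : Integrable f μ :=
  Integrable.of_bound hf.aestronglyMeasurable C (ae_of_all _ hb)

variable {μK : Measure (Matrix (Fin n) (Fin n) ℝ)}

theorem int_left {K : Set (Matrix (Fin n) (Fin n) ℝ)}
    (hμinv : ∀ A ∈ K, Measure.map (fun B => A * B) μK = μK)
    {B : Matrix (Fin n) (Fin n) ℝ} (hB : B ∈ K)
    {f : Matrix (Fin n) (Fin n) ℝ → ℂ} (hf : Continuous f) :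
    ∫ A, f (B * A) ∂μK = ∫ A, f A ∂μK := by
  conv_rhs => rw [← hμinv B hB]
  have : Continuous fun A : Matrix (Fin n) (Fin n) ℝ => B * A := by fun_prop
  rw [integral_map this.measurable.aemeasurable hf.aestronglyMeasurable]

theorem int_inv [IsProbabilityMeasure μK] {K : Set (Matrix (Fin n) (Fin n) ℝ)}
    (hKinv : ∀ A ∈ K, Aᵀ ∈ K) (hμsupp : μK Kᶜ = 0)
    (hμinv : ∀ A ∈ K, Measure.map (fun B => A * B) μK = μK)
    {f : Matrix (Fin n) (Fin n) ℝ → ℂ} (hf : Continuous f) {C : ℝ} (hb : ∀ A, ‖f A‖ ≤ C) :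
    ∫ A, f A ∂μK = ∫ A, f Aᵀ ∂μK := by
  have := mat_sc n
  have hK : ∀ᵐ A ∂μK, A ∈ K := hμsupp
  calc ∫ A, f A ∂μK = ∫ B, (∫ A, f (Bᵀ * A) ∂μK) ∂μK := by
        have : ∀ᵐ B ∂μK, (∫ A, f (Bᵀ * A) ∂μK) = ∫ A, f A ∂μK := by
          filter_upwards [hK] with B hB
          exact int_left hμinv (hKinv B hB) hf
        rw [integral_congr_ae this]; simp
    _ = ∫ A, (∫ B, f (Bᵀ * A) ∂μK) ∂μK := by
        refine integral_integral_swap (bdd_int (C := C) ?_ fun p => hb _)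
        simp only [Function.uncurry_def]
        fun_prop
    _ = ∫ A, f Aᵀ ∂μK := by
        have : ∀ᵐ A ∂μK, (∫ B, f (Bᵀ * A) ∂μK) = ∫ B, f Bᵀ ∂μK := by
          filter_upwards [hK] with A hA
          rw [← int_left hμinv (hKinv A hA) (f := fun B => f Bᵀ) (by fun_prop)]
          simp
        rw [integral_congr_ae this]; simp

noncomputable def phi (μK : Measure (Matrix (Fin n) (Fin n) ℝ)) (v x : Fin n → ℝ) : ℂ :=
  ∫ A, ee (A.mulVec v) x ∂μK

theorem phi_cont [IsProbabilityMeasure μK] :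
    Continuous fun p : (Fin n → ℝ) × (Fin n → ℝ) => phi μK p.1 p.2 := by
  unfold phi
  refine continuous_of_dominated (bound := fun _ => 1) (fun p => ?_) (fun p => ?_)
    (by simp) (ae_of_all _ fun A => by fun_prop)
  · exact Continuous.aestronglyMeasurable (by fun_prop)
  · exact ae_of_all _ fun A => (ee_norm _ _).le

theorem phi_cont_l [IsProbabilityMeasure μK] (x : Fin n → ℝ) :
    Continuous fun v => phi μK v x := by
  have h : Continuous fun v : Fin n → ℝ => ((v, x) : (Fin n → ℝ) × (Fin n → ℝ)) := by fun_prop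
  have h2 := Continuous.comp (phi_cont (μK := μK)) h
  exact h2

theorem phi_cont_r [IsProbabilityMeasure μK] (v : Fin n → ℝ) :
    Continuous fun x => phi μK v x := by
  have h : Continuous fun x : Fin n → ℝ => ((v, x) : (Fin n → ℝ) × (Fin n → ℝ)) := by fun_prop
  have h2 := Continuous.comp (phi_cont (μK := μK)) h
  exact h2

theorem phi_bound [IsProbabilityMeasure μK] (v x : Fin n → ℝ) : ‖phi μK v x‖ ≤ 1 := by
  unfold phi
  refine (norm_integral_le_of_norm_le_const (C := 1)
    (ae_of_all _ fun A => (ee_norm _ _).le)).trans (by simp)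

theorem phi_zero [IsProbabilityMeasure μK] (v : Fin n → ℝ) : phi μK v 0 = 1 := by
  simp [phi, ee_zero]

theorem phi_pd [IsProbabilityMeasure μK] (v : Fin n → ℝ) : IsPosDefFn (phi μK v) :=
  pd_integral (fun A => ee_pd (A.mulVec v)) fun x =>
    bdd_int (C := 1) (by fun_prop) fun A => (ee_norm _ _).le

theorem phi_inv {K : Set (Matrix (Fin n) (Fin n) ℝ)}
    (hKinv : ∀ A ∈ K, Aᵀ ∈ K)
    (hμinv : ∀ A ∈ K, Measure.map (fun B => A * B) μK = μK)
    {C : Matrix (Fin n) (Fin n) ℝ} (hC : C ∈ K) (v x : Fin n → ℝ) :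
    phi μK v (C.mulVec x) = phi μK v x := by
  unfold phi
  rw [← int_left hμinv (hKinv C hC) (f := fun A => ee (A.mulVec v) x) (by fun_prop)]
  simp_rw [← Matrix.mulVec_mulVec, ee_adj Cᵀ, Matrix.transpose_transpose]

theorem phi_alt [IsProbabilityMeasure μK] {K : Set (Matrix (Fin n) (Fin n) ℝ)}
    (hKinv : ∀ A ∈ K, Aᵀ ∈ K) (hμsupp : μK Kᶜ = 0)
    (hμinv : ∀ A ∈ K, Measure.map (fun B => A * B) μK = μK) (v x : Fin n → ℝ) :
    phi μK v x = ∫ A, ee v (A.mulVec x) ∂μK := by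
  unfold phi
  rw [int_inv (C := 1) hKinv hμsupp hμinv (by fun_prop) (fun A => (ee_norm _ _).le)]
  simp_rw [ee_adj, Matrix.transpose_transpose]

theorem phi_orb [IsProbabilityMeasure μK] {K : Set (Matrix (Fin n) (Fin n) ℝ)}
    (hKinv : ∀ A ∈ K, Aᵀ ∈ K) (hμsupp : μK Kᶜ = 0)
    (hμinv : ∀ A ∈ K, Measure.map (fun B => A * B) μK = μK)
    {B : Matrix (Fin n) (Fin n) ℝ} (hB : B ∈ K) (v x : Fin n → ℝ) :
    phi μK (B.mulVec v) x = phi μK v x := by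
  rw [phi_alt hKinv hμsupp hμinv, phi_alt hKinv hμsupp hμinv,
    ← int_left hμinv (hKinv B hB) (f := fun A => ee v (A.mulVec x)) (by fun_prop)]
  simp_rw [ee_adj, Matrix.mulVec_mulVec]

theorem avg [IsProbabilityMeasure μK] {K : Set (Matrix (Fin n) (Fin n) ℝ)}
    (hKinv : ∀ A ∈ K, Aᵀ ∈ K) (hμsupp : μK Kᶜ = 0)
    (hμinv : ∀ A ∈ K, Measure.map (fun B => A * B) μK = μK)
    {G : (Fin n → ℝ) → ℂ} (hG : ∀ A ∈ K, ∀ x, G (A.mulVec x) = G x)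
    {μ : Measure (Fin n → ℝ)} [IsProbabilityMeasure μ] (h : ∀ x, G x = ∫ v, ee v x ∂μ)
    (x : Fin n → ℝ) : G x = ∫ v, phi μK v x ∂μ := by
  have hK : ∀ᵐ A ∂μK, A ∈ K := hμsupp
  have h1 : ∀ᵐ A ∂μK, G (A.mulVec x) = G x := by
    filter_upwards [hK] with A hA using hG A hA x
  calc G x = ∫ A, G (A.mulVec x) ∂μK := by rw [integral_congr_ae h1]; simp
    _ = ∫ A, ∫ v, ee v (A.mulVec x) ∂μ ∂μK := by simp_rw [h]
    _ = ∫ v, ∫ A, ee v (A.mulVec x) ∂μK ∂μ := by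
        refine integral_integral_swap (bdd_int (C := 1) ?_ fun p => (ee_norm _ _).le)
        simp only [Function.uncurry_def]
        fun_prop
    _ = _ := by simp_rw [phi_alt hKinv hμsupp hμinv]

theorem mix_cont [IsProbabilityMeasure μK] {ρ : Measure (Fin n → ℝ)} [IsProbabilityMeasure ρ] :
    Continuous fun x => ∫ v, phi μK v x ∂ρ := by
  refine continuous_of_dominated (bound := fun _ => 1) (fun p => ?_) (fun p => ?_)
    (by simp) (ae_of_all _ fun A => phi_cont_r A)
  · exact (phi_cont_l p).aestronglyMeasurable
  · exact ae_of_all _ fun A => phi_bound _ _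

theorem phi_int [IsProbabilityMeasure μK] {ρ : Measure (Fin n → ℝ)} [IsFiniteMeasure ρ]
    (x : Fin n → ℝ) : Integrable (fun v => phi μK v x) ρ :=
  bdd_int (C := 1) (phi_cont_l x)
    fun v => phi_bound _ _

theorem mix_mem [IsProbabilityMeasure μK] {K : Set (Matrix (Fin n) (Fin n) ℝ)}
    (hKinv : ∀ A ∈ K, Aᵀ ∈ K)
    (hμinv : ∀ A ∈ K, Measure.map (fun B => A * B) μK = μK)
    {ρ : Measure (Fin n → ℝ)} [IsProbabilityMeasure ρ] :
    (fun x => ∫ v, phi μK v x ∂ρ) ∈ {Γ : (Fin n → ℝ) → ℂ | Continuous Γ ∧ IsPosDefFn Γ ∧ Γ 0 = 1 ∧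
      ∀ A ∈ K, ∀ x, Γ (A.mulVec x) = Γ x} := by
  refine ⟨mix_cont, pd_integral (fun v => phi_pd v) phi_int, ?_, ?_⟩
  · simp [phi_zero]
  · intro A hA x
    simp_rw [phi_inv hKinv hμinv hA]

theorem orbit_closed {K : Set (Matrix (Fin n) (Fin n) ℝ)} (hKclosed : IsClosed K)
    (hKorth : ∀ A ∈ K, A * Aᵀ = 1) (v : Fin n → ℝ) :
    IsClosed ((fun A : Matrix (Fin n) (Fin n) ℝ => A.mulVec v) '' K) := by
  have hc : IsCompact K := by
    have h2 : IsCompact (Set.pi Set.univ fun _ : Fin n =>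
        Set.pi Set.univ fun _ : Fin n => Set.Icc (-1 : ℝ) 1) :=
      isCompact_univ_pi fun _ => isCompact_univ_pi fun _ => isCompact_Icc
    refine IsCompact.of_isClosed_subset (X := Matrix (Fin n) (Fin n) ℝ) h2 hKclosed ?_
    intro A hA i _ j _
    have h := congrFun (congrFun (hKorth A hA) i) i
    rw [Matrix.mul_apply] at h
    simp only [Matrix.transpose_apply, Matrix.one_apply_eq] at h
    have : A i j * A i j ≤ 1 := by
      rw [← h]
      exact Finset.single_le_sum (f := fun j => A i j * A i j)
        (fun k _ => mul_self_nonneg _) (Finset.mem_univ j)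
    exact abs_le.1 (abs_le_one_iff_mul_self_le_one.2 this)
  exact (hc.image (by fun_prop)).isClosed

theorem ext_back [IsProbabilityMeasure μK] {K : Set (Matrix (Fin n) (Fin n) ℝ)}
    (hKclosed : IsClosed K) (hKorth : ∀ A ∈ K, A * Aᵀ = 1)
    (hKinv : ∀ A ∈ K, Aᵀ ∈ K) (hμsupp : μK Kᶜ = 0)
    (hμinv : ∀ A ∈ K, Measure.map (fun B => A * B) μK = μK)
    {v₀ : Fin n → ℝ} {G1 G2 : (Fin n → ℝ) → ℂ}
    (h1 : G1 ∈ {Γ : (Fin n → ℝ) → ℂ | Continuous Γ ∧ IsPosDefFn Γ ∧ Γ 0 = 1 ∧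
      ∀ A ∈ K, ∀ x, Γ (A.mulVec x) = Γ x})
    (h2 : G2 ∈ {Γ : (Fin n → ℝ) → ℂ | Continuous Γ ∧ IsPosDefFn Γ ∧ Γ 0 = 1 ∧
      ∀ A ∈ K, ∀ x, Γ (A.mulVec x) = Γ x})
    {a b : ℝ} (ha : 0 < a) (hb : 0 < b) (h : a • G1 + b • G2 = phi μK v₀) :
    G1 = phi μK v₀ := by
  obtain ⟨μ, hμ, hF⟩ := bochner_pi h1.2.1 h1.2.2.1 h1.1
  obtain ⟨ν, hν, hF2⟩ := bochner_pi h2.2.1 h2.2.2.1 h2.1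
  change ∀ x, G1 x = ∫ v, ee v x ∂μ at hF
  change ∀ x, G2 x = ∫ v, ee v x ∂ν at hF2
  have hcm : Continuous (fun A : Matrix (Fin n) (Fin n) ℝ => A.mulVec v₀) := by fun_prop
  have hm := hcm.measurable
  have ei : ∀ (x : Fin n → ℝ) (ρ : Measure (Fin n → ℝ)) [IsFiniteMeasure ρ],
      Integrable (fun v => ee v x) ρ := fun x ρ _ =>
    bdd_int (C := 1) (by fun_prop) fun v => (ee_norm _ _).le
  have key : μK.map (fun A => A.mulVec v₀)
      = a.toNNReal • μ + b.toNNReal • ν := by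
    apply char_ext
    intro x
    change ∫ v, ee v x ∂_ = ∫ v, ee v x ∂_
    rw [integral_map hm.aemeasurable (Continuous.aestronglyMeasurable (by fun_prop)),
      integral_add_measure (ei x _) (ei x _), integral_smul_nnreal_measure,
      integral_smul_nnreal_measure, ← hF, ← hF2, NNReal.smul_def, NNReal.smul_def,
      Real.coe_toNNReal a ha.le, Real.coe_toNNReal b hb.le]
    exact (congrFun h x).symm
  have hS := orbit_closed hKclosed hKorth v₀
  have h0 : μK.map (fun A => A.mulVec v₀)
      ((fun A : Matrix (Fin n) (Fin n) ℝ => A.mulVec v₀) '' K)ᶜ = 0 := by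
    rw [Measure.map_apply hm hS.measurableSet.compl]
    refine measure_mono_null ?_ hμsupp
    intro A hA hAK
    exact hA ⟨A, hAK, rfl⟩
  rw [key, Measure.add_apply, add_eq_zero] at h0
  have h00 := h0.1
  rw [Measure.smul_apply, smul_eq_zero] at h00
  have h3 : μ ((fun A : Matrix (Fin n) (Fin n) ℝ => A.mulVec v₀) '' K)ᶜ = 0 := by
    rcases h00 with h00 | h00
    · exact absurd (Real.toNNReal_eq_zero.1 h00) (not_le.2 ha)
    · exact h00
  have h4 : ∀ᵐ v ∂μ, v ∈ (fun A : Matrix (Fin n) (Fin n) ℝ => A.mulVec v₀) '' K := h3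
  ext x
  rw [avg hKinv hμsupp hμinv h1.2.2.2 hF x]
  have h5 : ∀ᵐ v ∂μ, phi μK v x = phi μK v₀ x := by
    filter_upwards [h4] with v hv
    obtain ⟨B, hB, rfl⟩ := hv
    exact phi_orb hKinv hμsupp hμinv hB _ _
  rw [integral_congr_ae h5]; simp

theorem ext_forw [IsProbabilityMeasure μK] {K : Set (Matrix (Fin n) (Fin n) ℝ)}
    (hKinv : ∀ A ∈ K, Aᵀ ∈ K) (hμsupp : μK Kᶜ = 0)
    (hμinv : ∀ A ∈ K, Measure.map (fun B => A * B) μK = μK)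
    {G : (Fin n → ℝ) → ℂ}
    (hG : G ∈ Set.extremePoints ℝ {Γ : (Fin n → ℝ) → ℂ | Continuous Γ ∧ IsPosDefFn Γ ∧ Γ 0 = 1 ∧
      ∀ A ∈ K, ∀ x, Γ (A.mulVec x) = Γ x}) :
    ∃ v, G = phi μK v := by
  obtain ⟨⟨gc, gp, g0, gi⟩, hext⟩ := hG
  obtain ⟨μ, hμ, hF⟩ := bochner_pi gp g0 gc
  change ∀ x, G x = ∫ v, ee v x ∂μ at hF
  have hA := avg hKinv hμsupp hμinv gi hF
  have hS : ∀ S, MeasurableSet S → ∀ x, ∫ v in S, phi μK v x ∂μ = μ.real S • G x := by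
    intro S hS x
    by_cases hs0 : μ S = 0
    · rw [Measure.restrict_eq_zero.2 hs0]; simp [measureReal_def, hs0]
    by_cases hs1 : μ Sᶜ = 0
    · have e1 : ∀ᵐ v ∂μ, v ∈ S := hs1
      rw [Measure.restrict_eq_self_of_ae_mem e1, ← hA]
      have : μ S = 1 := (prob_compl_eq_zero_iff hS).1 hs1
      simp [measureReal_def, this]
    have mk : ∀ T, μ T ≠ 0 → (fun x => (μ.real T)⁻¹ • ∫ v in T, phi μK v x ∂μ) ∈
        {Γ : (Fin n → ℝ) → ℂ | Continuous Γ ∧ IsPosDefFn Γ ∧ Γ 0 = 1 ∧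
          ∀ A ∈ K, ∀ x, Γ (A.mulVec x) = Γ x} := by
      intro T hT
      have : IsProbabilityMeasure ((μ T)⁻¹ • μ.restrict T) := ⟨by
        simp [ENNReal.inv_mul_cancel hT (measure_ne_top _ _)]⟩
      have := mix_mem (μK := μK) (K := K) hKinv hμinv (ρ := (μ T)⁻¹ • μ.restrict T)
      simpa only [integral_smul_measure, ENNReal.toReal_inv, measureReal_def] using this
    have p1 : 0 < μ.real S := ENNReal.toReal_pos hs0 (measure_ne_top _ _)
    have p2 : 0 < μ.real Sᶜ := ENNReal.toReal_pos hs1 (measure_ne_top _ _)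
    have := hext (mk S hs0) (mk Sᶜ hs1) ⟨μ.real S, μ.real Sᶜ, p1, p2,
      by rw [measureReal_add_measureReal_compl hS]; simp, by
        ext x
        simp only [Pi.add_apply, Pi.smul_apply]
        rw [smul_inv_smul₀ p1.ne', smul_inv_smul₀ p2.ne', integral_add_compl hS (phi_int x), ← hA]⟩
    rw [← congrFun this x, smul_inv_smul₀ p1.ne']
  have hae : ∀ x, ∀ᵐ v ∂μ, phi μK v x = G x := by
    intro x
    refine Integrable.ae_eq_of_forall_setIntegral_eq (fun v => phi μK v x) (fun _ => G x)
      (phi_int x) (integrable_const _) fun S hs _ => ?_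
    rw [hS S hs x]; simp
  have hall : ∀ᵐ v ∂μ, ∀ k : ℕ, phi μK v (TopologicalSpace.denseSeq (Fin n → ℝ) k)
      = G (TopologicalSpace.denseSeq (Fin n → ℝ) k) := ae_all_iff.2 fun k => hae _
  obtain ⟨v, hv⟩ := hall.exists
  refine ⟨v, ?_⟩
  refine (Continuous.ext_on (TopologicalSpace.denseRange_denseSeq (Fin n → ℝ))
    (phi_cont_r v) gc ?_).symm
  rintro _ ⟨k, rfl⟩
  exact hv k
end
/-- **Proposition 3.2.** Let `K` be a closed subgroup of `O(n)` with normalized Haar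
probability measure `μK`.  Let `𝒞` be the convex set of continuous positive definite
`K`-invariant functions `Γ : ℝⁿ → ℂ` with `Γ(0) = 1`, a convex subset of the real vector space
of functions `ℝⁿ → ℂ`.  Then `Γ ∈ 𝒞` is an extreme point of `𝒞` if and only if `Γ` is the
Fourier transform `φ_{v₀}(x) = ∫_K exp(i ⟨k v₀, x⟩) dμK(k)` of a `K`-orbit in `ℝⁿ`. -/
theorem extreme_points_are_orbit_fourier_transforms
    (n : ℕ) (hn : 1 ≤ n)
    [MeasurableSpace (Matrix (Fin n) (Fin n) ℝ)] [BorelSpace (Matrix (Fin n) (Fin n) ℝ)]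
    (K : Set (Matrix (Fin n) (Fin n) ℝ)) (hKclosed : IsClosed K)
    (hKorth : ∀ A ∈ K, A * Aᵀ = 1)
    (hKone : (1 : Matrix (Fin n) (Fin n) ℝ) ∈ K)
    (hKmul : ∀ A ∈ K, ∀ B ∈ K, A * B ∈ K)
    (hKinv : ∀ A ∈ K, Aᵀ ∈ K)
    -- `μK` is the normalized Haar measure of `K`: a left-invariant probability measure
    -- carried by `K`
    (μK : Measure (Matrix (Fin n) (Fin n) ℝ)) [IsProbabilityMeasure μK]
    (hμsupp : μK Kᶜ = 0)
    (hμinv : ∀ A ∈ K, Measure.map (fun B => A * B) μK = μK)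
    -- the convex set of continuous positive definite `K`-invariant states on `ℝⁿ`
    (𝒞 : Set ((Fin n → ℝ) → ℂ))
    (h𝒞 : 𝒞 = {Γ | Continuous Γ ∧ IsPosDefFn Γ ∧ Γ 0 = 1 ∧
      ∀ A ∈ K, ∀ x, Γ (A.mulVec x) = Γ x})
    (Γ : (Fin n → ℝ) → ℂ) (hΓ : Γ ∈ 𝒞) :
    Γ ∈ Set.extremePoints ℝ 𝒞 ↔
      ∃ v₀ : Fin n → ℝ,
        Γ = fun x => ∫ A, Complex.exp (Complex.I * (↑(∑ i, A.mulVec v₀ i * x i) : ℂ)) ∂μK := by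
  subst h𝒞
  constructor
  · exact fun h => ext_forw hKinv hμsupp hμinv h
  · rintro ⟨v₀, hv⟩
    refine ⟨hΓ, fun G1 h1 G2 h2 hs => ?_⟩
    obtain ⟨a, b, ha, hb, -, h⟩ := hs
    have hv' : Γ = phi μK v₀ := hv
    rw [hv'] at h ⊢
    exact ext_back hKclosed hKorth hKinv hμsupp hμinv h1 h2 ha hb h
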